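/- Let n ≥ 1 and let 𝒯 = {K_1, …, K_q} be a triangle patch around a point z ∈ ℝ². Let Π_n^𝒯 denote the restriction to P_n(Ω) (bivariate polynomials of total degree ≤ n on Ω) of the orthogonal projection, with respect to (u,v)_𝒯 := Σ_{i=1}^q (u,v)_{K_i}, of the space of piecewise polynomials of degree ≤ n on the patch onto the space of piecewise polynomials of degree ≤ n−1 on the patch. Then Π_n^𝒯 : P_n(Ω) → P_{n−1}(𝒯) is injective. -/

import Mathlib

open MeasureTheory Finset

noncomputable section

/-- 2×2 determinant of two vectors in `ℝ²`. -/
def det2 (u v : ℝ × ℝ) : ℝ := u.1 * v.2 - u.2 * v.1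

/-- The open triangle with vertices `A`, `B`, `C` (interior of the convex hull). -/
def tri (A B C : ℝ × ℝ) : Set (ℝ × ℝ) := interior (convexHull ℝ {A, B, C})

/-- Barycentric coordinate of `p` with respect to the vertex `A` of triangle `ABC`. -/
def bary (A B C p : ℝ × ℝ) : ℝ := det2 (p - B) (C - B) / det2 (A - B) (C - B)

/-- The cubic bubble: product of the three barycentric coordinates of triangle `ABC`. -/
def bubble (A B C p : ℝ × ℝ) : ℝ := bary A B C p * bary B C A p * bary C A B p

/-- Evaluation of a bivariate polynomial at a point of `ℝ²`. -/
def evalP (u : MvPolynomial (Fin 2) ℝ) (p : ℝ × ℝ) : ℝ :=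
  MvPolynomial.eval ![p.1, p.2] u

/-- The inner product `(u,v)_K := ∫_K u v ω_K` on the open triangle `K = conv°(A,B,C)`,
with weight the product of the barycentric coordinates. -/
def innerT (A B C : ℝ × ℝ) (u v : MvPolynomial (Fin 2) ℝ) : ℝ :=
  ∫ p in tri A B C, evalP u p * evalP v p * bubble A B C p

/-- `u ∈ P_{n-1}^⊥(K)` for `K = conv°(A,B,C)`: `u` has total degree at most `n` and is
orthogonal to every polynomial of total degree at most `n-1` w.r.t. `(·,·)_K`. -/
def inPerp (n : ℕ) (A B C : ℝ × ℝ) (u : MvPolynomial (Fin 2) ℝ) : Prop :=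
  u.totalDegree ≤ n ∧
    ∀ w : MvPolynomial (Fin 2) ℝ, w.totalDegree ≤ n - 1 → innerT A B C u w = 0

/-- A triangle patch around a point `z`: `q ≥ 3` pairwise disjoint nondegenerate open
triangles `K_i = conv°(z, A_{i-1}, A_i)` (indices cyclic, i.e. in `ZMod q`), consecutive ones
sharing the edge from `z` to `A_i`, whose closed union covers a neighbourhood of `z`. -/
structure TrianglePatch (q : ℕ) where
  hq : 3 ≤ q
  z : ℝ × ℝ
  A : ZMod q → ℝ × ℝ
  indep : ∀ i : ZMod q, AffineIndependent ℝ ![z, A (i - 1), A i]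
  disj : Pairwise fun i j : ZMod q =>
    Disjoint (tri z (A (i - 1)) (A i)) (tri z (A (j - 1)) (A j))
  covers : ∃ ε > 0, Metric.ball z ε ⊆ ⋃ i : ZMod q, closure (tri z (A (i - 1)) (A i))

/-- The `i`-th triangle of a patch. -/
def TrianglePatch.K {q : ℕ} (T : TrianglePatch q) (i : ZMod q) : Set (ℝ × ℝ) :=
  tri T.z (T.A (i - 1)) (T.A i)

/-- `Ω`: the interior of the union of the closed triangles of the patch. -/
def TrianglePatch.Omega {q : ℕ} (T : TrianglePatch q) : Set (ℝ × ℝ) :=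
  interior (⋃ i : ZMod q, closure (tri T.z (T.A (i - 1)) (T.A i)))

/-- The patch inner product `(u,v)_𝒯 = Σ_i (u_i, v_i)_{K_i}` of two piecewise polynomials
(given as tuples of polynomials, one for each triangle). -/
def patchInner {q : ℕ} (T : TrianglePatch q)
    (u v : ZMod q → MvPolynomial (Fin 2) ℝ) : ℝ :=
  haveI : NeZero q := ⟨by have := T.hq; omega⟩
  ∑ i : ZMod q, innerT T.z (T.A (i - 1)) (T.A i) (u i) (v i)

/-- Integral of a real polynomial over the unit interval. -/
def unitInt (p : Polynomial ℝ) : ℝ := ∫ s in Set.Ioo (0 : ℝ) 1, p.eval s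

lemma Polynomial.integrableOn_Ioo_zero_one (p : Polynomial ℝ) :
    IntegrableOn (fun s => p.eval s) (Set.Ioo (0 : ℝ) 1) :=
  (p.continuous.continuousOn.integrableOn_Icc).mono_set Set.Ioo_subset_Icc_self

lemma unitInt_add (p r : Polynomial ℝ) : unitInt (p + r) = unitInt p + unitInt r := by
  simp only [unitInt, Polynomial.eval_add]
  exact integral_add p.integrableOn_Ioo_zero_one r.integrableOn_Ioo_zero_one

lemma unitInt_sub (p r : Polynomial ℝ) : unitInt (p - r) = unitInt p - unitInt r := by
  simp only [unitInt, Polynomial.eval_sub]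
  exact integral_sub p.integrableOn_Ioo_zero_one r.integrableOn_Ioo_zero_one

lemma unitInt_C_mul (c : ℝ) (p : Polynomial ℝ) :
    unitInt (Polynomial.C c * p) = c * unitInt p := by
  simp only [unitInt, Polynomial.eval_mul, Polynomial.eval_C]
  exact integral_const_mul _ _

lemma unitInt_sum {ι : Type*} (s : Finset ι) (f : ι → Polynomial ℝ) :
    unitInt (∑ i ∈ s, f i) = ∑ i ∈ s, unitInt (f i) := by
  simp only [unitInt, Polynomial.eval_finsetSum]
  exact integral_finsetSum _ fun i _ => (f i).integrableOn_Ioo_zero_one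

lemma Polynomial.eq_zero_of_eval_Ioo_eq_zero {p : Polynomial ℝ}
    (h : ∀ s ∈ Set.Ioo (0 : ℝ) 1, p.eval s = 0) : p = 0 :=
  Polynomial.eq_zero_of_infinite_isRoot p ((Set.Ioo_infinite one_pos).mono h)

lemma eq_zero_of_unitInt_eq_zero {p : Polynomial ℝ}
    (h : ∀ s ∈ Set.Ioo (0 : ℝ) 1, 0 ≤ p.eval s) (h0 : unitInt p = 0) : p = 0 := by
  have h1 := (setIntegral_eq_zero_iff_of_nonneg_ae
    ((ae_restrict_iff' measurableSet_Ioo).2 (ae_of_all _ h)) p.integrableOn_Ioo_zero_one).1 h0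
  have h2 := Measure.eqOn_open_of_ae_eq (μ := volume) h1 isOpen_Ioo
    p.continuous.continuousOn continuousOn_const
  exact Polynomial.eq_zero_of_eval_Ioo_eq_zero h2

lemma unitInt_derivative {p : Polynomial ℝ} (h0 : p.eval 0 = 0) (h1 : p.eval 1 = 0) :
    unitInt (Polynomial.derivative p) = 0 := by
  rw [unitInt, ← integral_Ioc_eq_integral_Ioo,
    ← intervalIntegral.integral_of_le zero_le_one,
    intervalIntegral.integral_eq_sub_of_hasDerivAt (f := fun s => p.eval s)
      (fun x _ => p.hasDerivAt x)
      ((Polynomial.continuous _).intervalIntegrable _ _), h0, h1, sub_zero]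

section OneVariable

open Polynomial

/-- The radial moments of an orthogonal polynomial vanishing to order `m` at the vertex. -/
lemma coeff_eq_zero_of_unitInt {n m : ℕ} {φ : ℝ[X]} (hm : 1 ≤ m) (hφ : φ.natDegree ≤ n)
    (hlow : ∀ l < m, φ.coeff l = 0)
    (horth : ∀ r : ℝ[X], m - 1 + r.natDegree ≤ n - 1 →
      unitInt (φ * (X ^ (m - 1) * r * (X ^ 3 * (1 - X)))) = 0) : φ = 0 := by
  by_contra hne
  obtain ⟨ψ, rfl⟩ := X_pow_dvd_iff.2 hlow
  have hψ : ψ ≠ 0 := right_ne_zero_of_mul hne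
  rw [natDegree_mul (pow_ne_zero _ X_ne_zero) hψ, natDegree_X_pow] at hφ
  have h := eq_zero_of_unitInt_eq_zero ?_ (horth ψ (by omega))
  · have h1 : (1 - X : ℝ[X]) ≠ 0 := fun h => by
      simpa using congrArg (eval 0) h
    simp [hψ, X_ne_zero, h1] at h
  · rintro s ⟨h0, h1⟩
    have : 0 < 1 - s := by linarith
    have : s ^ m * (eval s ψ) * (s ^ (m - 1) * eval s ψ * (s ^ 3 * (1 - s)))
      = s ^ m * s ^ (m - 1) * (eval s ψ) ^ 2 * (s ^ 3 * (1 - s)) := by ring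
    simp only [eval_mul, eval_pow, eval_X, eval_sub, eval_one, this]
    positivity

/-- A nonzero radial Jacobi polynomial has nonzero value and nonzero derivative at the vertex. -/
lemma eq_zero_of_coeff_zero {n : ℕ} {φ : ℝ[X]} (hφ : φ.natDegree ≤ n)
    (horth : ∀ r : ℝ[X], r.natDegree ≤ n - 1 → unitInt (φ * (r * (X ^ 3 * (1 - X)))) = 0)
    (h0 : φ.coeff 0 = 0) : φ = 0 := by
  refine coeff_eq_zero_of_unitInt le_rfl hφ (m := 1) (fun l hl => ?_) fun r hr => ?_
  · obtain rfl : l = 0 := by omega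
    exact h0
  · simpa using horth r (by omega)

lemma eq_zero_of_coeff_one {n : ℕ} {φ : ℝ[X]} (hn : 1 ≤ n) (hφ : φ.natDegree ≤ n)
    (horth : ∀ r : ℝ[X], r.natDegree ≤ n - 1 → unitInt (φ * (r * (X ^ 3 * (1 - X)))) = 0)
    (h1 : φ.coeff 1 = 0) : φ = 0 := by
  have hX1 : (1 - X : ℝ[X]) ≠ 0 := fun h => by simpa using congrArg (eval 0) h
  have hd : derivative φ = 0 := by
    by_contra hne
    have hdeg : (derivative φ).natDegree ≤ n - 1 := (natDegree_derivative_le φ).trans (by omega)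
    obtain ⟨ψ, hψ⟩ : X ∣ derivative φ := X_dvd_iff.2 (by simp [coeff_derivative, h1])
    have hψ0 : ψ ≠ 0 := by rintro rfl; simp [hψ] at hne
    rw [hψ, natDegree_mul X_ne_zero hψ0, natDegree_X] at hdeg
    have key := unitInt_derivative (p := φ * (X ^ 4 * (1 - X) ^ 2 * ψ)) (by simp) (by simp)
    set r : ℝ[X] := (4 * (1 - X) - 2 * X) * ψ + X * (1 - X) * derivative ψ with hr
    have hrdeg : r.natDegree ≤ n - 1 := by
      have e1 : (4 * (1 - X) - 2 * X : ℝ[X]).natDegree ≤ 1 := by compute_degree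
      have e2 : (X * (1 - X) : ℝ[X]).natDegree ≤ 2 := by compute_degree
      refine (natDegree_add_le _ _).trans (max_le ?_ ?_)
      · exact natDegree_mul_le.trans (by omega)
      · by_cases hz : ψ.natDegree = 0
        · rw [derivative_of_natDegree_zero hz]; simp
        · have := natDegree_derivative_le ψ
          exact natDegree_mul_le.trans (by omega)
    have e : derivative (φ * (X ^ 4 * (1 - X) ^ 2 * ψ))
        = X ^ 5 * (1 - X) ^ 2 * ψ ^ 2 + φ * (r * (X ^ 3 * (1 - X))) := by
      have : derivative (X ^ 4 * (1 - X) ^ 2 * ψ : ℝ[X]) = r * (X ^ 3 * (1 - X)) := by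
        simp only [derivative_mul, derivative_pow, derivative_X, derivative_sub, derivative_one, hr]
        simp [map_ofNat C]
        ring
      rw [derivative_mul, this, hψ]
      ring
    rw [e, unitInt_add, horth r hrdeg, add_zero] at key
    have := eq_zero_of_unitInt_eq_zero (fun s hs => ?_) key
    · simp [hψ0, hX1, X_ne_zero] at this
    · simp only [eval_mul, eval_pow, eval_X, eval_sub, eval_one]
      have := hs.1
      positivity
  obtain ⟨c, rfl⟩ : ∃ c, φ = C c := ⟨_, eq_C_of_derivative_eq_zero hd⟩
  have h := eq_zero_of_unitInt_eq_zero (fun s hs => ?_) (horth (C c) (by simp))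
  · by_contra hc
    simp [hX1, X_ne_zero, hc] at h
  · have := hs.1
    have : 0 < 1 - s := by linarith [hs.2]
    simp only [eval_mul, eval_pow, eval_X, eval_sub, eval_one, eval_C, ← mul_assoc]
    have := mul_self_nonneg c
    positivity

/-- A nonzero polynomial of degree at most `m` orthogonal to all polynomials of lower degree with
respect to the weight `t (1 - t)` has degree exactly `m` and all its roots in `(0, 1)`. -/
lemma orthogonal_roots {m : ℕ} {f : ℝ[X]} (hm : 1 ≤ m) (hf : f ≠ 0) (hdeg : f.natDegree ≤ m)
    (horth : ∀ j < m, unitInt (f * X ^ j * (X * (1 - X))) = 0) :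
    f.coeff m ≠ 0 ∧ (∀ t, f.eval t = 0 → 0 < t ∧ t < 1) ∧ ∃ t, f.eval t = 0 := by
  have hX1 : (1 - X : ℝ[X]) ≠ 0 := fun h => by simpa using congrArg (eval 0) h
  have horth' : ∀ p : ℝ[X], p.natDegree < m → unitInt (f * p * (X * (1 - X))) = 0 := by
    intro p hp
    have : f * p * (X * (1 - X))
        = ∑ j ∈ range m, C (p.coeff j) * (f * X ^ j * (X * (1 - X))) := by
      conv_lhs => rw [p.as_sum_range_C_mul_X_pow' hp]
      rw [mul_sum, sum_mul]
      exact sum_congr rfl fun j _ => by ring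
    rw [this, unitInt_sum]
    exact sum_eq_zero fun j hj => by rw [unitInt_C_mul, horth j (mem_range.1 hj), mul_zero]
  have hw : ∀ s ∈ Set.Ioo (0 : ℝ) 1, 0 < s * (1 - s) := fun s hs =>
    mul_pos hs.1 (by linarith [hs.2])
  refine ⟨fun hc => ?_, fun t ht => ?_, ?_⟩
  · have hlt : f.natDegree < m := by
      refine lt_of_le_of_ne hdeg fun h => hf ?_
      rwa [← h, coeff_natDegree, leadingCoeff_eq_zero] at hc
    have := eq_zero_of_unitInt_eq_zero (fun s hs => ?_) (horth' f hlt)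
    · simp [hf, hX1, X_ne_zero] at this
    · simp only [eval_mul, eval_X, eval_sub, eval_one]
      exact mul_nonneg (mul_self_nonneg _) (hw s hs).le
  · obtain ⟨g, rfl⟩ := dvd_iff_isRoot.2 ht
    have hg : g ≠ 0 := right_ne_zero_of_mul hf
    rw [natDegree_mul (X_sub_C_ne_zero t) hg, natDegree_X_sub_C] at hdeg
    have key := horth' g (by omega)
    by_contra hcon
    have hsgn : t ≤ 0 ∨ 1 ≤ t := by
      by_contra! h
      exact hcon h
    have hne : (X - C t) * g * g * (X * (1 - X)) ≠ 0 := by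
      simp [hg, hX1, X_ne_zero, X_sub_C_ne_zero]
    rcases hsgn with h | h
    · refine hne (eq_zero_of_unitInt_eq_zero (fun s hs => ?_) key)
      simp only [eval_mul, eval_X, eval_sub, eval_one, eval_C, mul_assoc (s - t)]
      have := mul_nonneg (mul_nonneg (by linarith [hs.1] : 0 ≤ s - t)
        (mul_self_nonneg (eval s g))) (hw s hs).le
      linarith
    · have key' : unitInt (C (-1) * ((X - C t) * g * g * (X * (1 - X)))) = 0 := by
        rw [unitInt_C_mul, key, mul_zero]
      refine mul_ne_zero (by simp) hne (eq_zero_of_unitInt_eq_zero (fun s hs => ?_) key')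
      simp only [eval_mul, eval_X, eval_sub, eval_one, eval_C, mul_assoc (s - t)]
      have := mul_nonneg (mul_nonneg (by linarith [hs.2] : 0 ≤ t - s)
        (mul_self_nonneg (eval s g))) (hw s hs).le
      linarith
  · by_contra! hno
    have key := horth' 1 (by rw [natDegree_one]; omega)
    rw [mul_one] at key
    have hne : f * (X * (1 - X)) ≠ 0 := by simp [hf, hX1, X_ne_zero]
    have hsign : (∀ t, 0 < f.eval t) ∨ ∀ t, f.eval t < 0 := by
      by_contra! h
      obtain ⟨⟨a, ha⟩, b, hb⟩ := h
      obtain ⟨c, hc⟩ := mem_range_of_exists_le_of_exists_ge f.continuous ⟨a, ha⟩ ⟨b, hb⟩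
      exact hno c hc
    rcases hsign with h | h
    · refine hne (eq_zero_of_unitInt_eq_zero (fun s hs => ?_) key)
      simp only [eval_mul, eval_X, eval_sub, eval_one]
      exact mul_nonneg (h s).le (hw s hs).le
    · have key' : unitInt (C (-1) * (f * (X * (1 - X)))) = 0 := by
        rw [unitInt_C_mul, key, mul_zero]
      refine mul_ne_zero (by simp) hne (eq_zero_of_unitInt_eq_zero (fun s hs => ?_) key')
      simp only [eval_mul, eval_X, eval_sub, eval_one, eval_C]
      have := mul_nonneg (neg_nonneg.2 (h s).le) (hw s hs).le
      linarith

end OneVariable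

section PlanePolynomials

open Polynomial

lemma evalP_smul {h : MvPolynomial (Fin 2) ℝ} {m : ℕ} (hh : h.IsHomogeneous m) (c : ℝ)
    (p : ℝ × ℝ) : evalP h (c • p) = c ^ m * evalP h p := by
  simp only [evalP, MvPolynomial.eval_eq', mul_sum, Fin.prod_univ_two]
  refine sum_congr rfl fun d hd => ?_
  have hdeg : d 0 + d 1 = m := by
    rw [hh.degree_eq_sum_deg_support hd, ← Finsupp.degree_apply, Finsupp.degree_eq_sum,
      Fin.sum_univ_two]
  simp only [Prod.smul_fst, Prod.smul_snd, smul_eq_mul, Matrix.cons_val_zero, Matrix.cons_val_one]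
  rw [← hdeg]
  ring

/-- The restriction of a bivariate polynomial to the line through `a` and `b`. -/
def edgePoly (a b : ℝ × ℝ) (h : MvPolynomial (Fin 2) ℝ) : ℝ[X] :=
  MvPolynomial.aeval ![C a.1 + C (b.1 - a.1) * X, C a.2 + C (b.2 - a.2) * X] h

lemma eval_edgePoly (a b : ℝ × ℝ) (h : MvPolynomial (Fin 2) ℝ) (t : ℝ) :
    (edgePoly a b h).eval t = evalP h (a + t • (b - a)) := by
  induction h using MvPolynomial.induction_on with
  | C c => simp [edgePoly, evalP]
  | add u v hu hv => simp only [edgePoly, evalP, map_add, eval_add] at *; rw [hu, hv]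
  | mul_X u i hu =>
    simp only [edgePoly, evalP, map_mul, eval_mul] at *
    rw [hu]
    fin_cases i <;> simp <;> ring_nf <;> simp

lemma natDegree_edgePoly_le (a b : ℝ × ℝ) {h : MvPolynomial (Fin 2) ℝ} {m : ℕ}
    (hh : h.totalDegree ≤ m) : (edgePoly a b h).natDegree ≤ m := by
  have := MvPolynomial.aeval_natDegree_le h hh
    ![C a.1 + C (b.1 - a.1) * X, C a.2 + C (b.2 - a.2) * X] (n := 1) (Fin.forall_fin_two.2
      ⟨by simp only [Matrix.cons_val_zero]; compute_degree,
        by simp only [Matrix.cons_val_one, Matrix.cons_val_fin_one]; compute_degree⟩)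
  rwa [mul_one] at this

lemma evalP_combination {h : MvPolynomial (Fin 2) ℝ} {m : ℕ} (hh : h.IsHomogeneous m)
    (a b : ℝ × ℝ) {x y : ℝ} (hxy : x + y ≠ 0) :
    evalP h (x • a + y • b) = (x + y) ^ m * (edgePoly a b h).eval (y / (x + y)) := by
  rw [eval_edgePoly, ← evalP_smul hh]
  congr 1
  ext <;> simp <;> field_simp <;> ring

lemma continuous_evalP (h : MvPolynomial (Fin 2) ℝ) : Continuous (evalP h) := by
  unfold evalP
  refine (MvPolynomial.continuous_eval h).comp (continuous_pi fun i => ?_)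
  fin_cases i <;> simp <;> fun_prop

lemma evalP_sub_eq_coeff {h : MvPolynomial (Fin 2) ℝ} {m : ℕ} (hh : h.IsHomogeneous m)
    (a b : ℝ × ℝ) : evalP h (b - a) = (edgePoly a b h).coeff m := by
  have hdeg := natDegree_edgePoly_le a b hh.totalDegree_le
  have key : (fun s : ℝ => ((edgePoly a b h).reflect m).eval s)
      = fun s : ℝ => evalP h (s • a + (b - a)) := by
    refine Continuous.ext_on (dense_compl_singleton (0 : ℝ)) (Polynomial.continuous _)
      ((continuous_evalP h).comp (by fun_prop)) fun s hs => ?_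
    have hs : s ≠ 0 := hs
    let _ := invertibleOfNonzero (inv_ne_zero hs)
    have h1 := eval₂_reflect_mul_pow (RingHom.id ℝ) s⁻¹ m _ hdeg
    simp only [invOf_eq_inv, inv_inv] at h1
    have h2 := evalP_combination hh a b (x := s - 1) (y := 1) (by simpa using hs)
    have h3 : (s - 1) • a + (1 : ℝ) • b = s • a + (b - a) := by module
    rw [h3, sub_add_cancel, one_div] at h2
    show _ = evalP h (s • a + (b - a))
    rw [h2, eval, eval, ← h1, mul_left_comm, ← mul_pow, mul_inv_cancel₀ hs, one_pow, mul_one]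
  have := congrFun key 0
  simp only [zero_smul, zero_add, ← coeff_zero_eq_eval_zero, coeff_reflect] at this
  rw [← this, revAt_le (Nat.zero_le m), Nat.sub_zero]

/-- Expansion of a polynomial around the point `z`. -/
def recenter (z : ℝ × ℝ) (u : MvPolynomial (Fin 2) ℝ) : MvPolynomial (Fin 2) ℝ :=
  MvPolynomial.aeval ![MvPolynomial.X 0 + MvPolynomial.C z.1, MvPolynomial.X 1 + MvPolynomial.C z.2] u

lemma evalP_aeval (u g₁ g₂ : MvPolynomial (Fin 2) ℝ) (p : ℝ × ℝ) :
    evalP (MvPolynomial.aeval ![g₁, g₂] u) p = evalP u (evalP g₁ p, evalP g₂ p) := by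
  induction u using MvPolynomial.induction_on with
  | C c => simp [evalP]
  | add u v hu hv => simp only [evalP, map_add] at *; rw [hu, hv]
  | mul_X u i hu =>
    simp only [evalP, map_mul] at *
    rw [hu]
    fin_cases i <;> simp

lemma evalP_recenter (z : ℝ × ℝ) (u : MvPolynomial (Fin 2) ℝ) (p : ℝ × ℝ) :
    evalP (recenter z u) p = evalP u (z + p) := by
  rw [recenter, evalP_aeval]
  simp [evalP, add_comm]

lemma totalDegree_recenter_le (z : ℝ × ℝ) (u : MvPolynomial (Fin 2) ℝ) :
    (recenter z u).totalDegree ≤ u.totalDegree := by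
  rw [recenter, MvPolynomial.aeval_def, MvPolynomial.eval₂_eq']
  refine MvPolynomial.totalDegree_finsetSum_le fun d hd => ?_
  have hX : ∀ (i : Fin 2) (c : ℝ),
      (MvPolynomial.X i + MvPolynomial.C c : MvPolynomial (Fin 2) ℝ).totalDegree ≤ 1 :=
    fun i c => (MvPolynomial.totalDegree_add _ _).trans (by simp)
  have hle := MvPolynomial.le_totalDegree hd
  rw [Finsupp.sum_fintype _ _ (by simp), Fin.sum_univ_two] at hle
  simp only [Fin.prod_univ_two, Matrix.cons_val_zero, Matrix.cons_val_one]
  refine (MvPolynomial.totalDegree_mul _ _).trans ?_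
  have h0 := (MvPolynomial.totalDegree_pow (MvPolynomial.X (0 : Fin 2) + MvPolynomial.C z.1) (d 0)).trans
    (Nat.mul_le_mul_left (d 0) (hX 0 z.1))
  have h1 := (MvPolynomial.totalDegree_pow (MvPolynomial.X (1 : Fin 2) + MvPolynomial.C z.2) (d 1)).trans
    (Nat.mul_le_mul_left (d 1) (hX 1 z.2))
  have h2 := MvPolynomial.totalDegree_mul ((MvPolynomial.X (0 : Fin 2) + MvPolynomial.C z.1) ^ d 0)
    ((MvPolynomial.X 1 + MvPolynomial.C z.2) ^ d 1)
  rw [MvPolynomial.algebraMap_eq, MvPolynomial.totalDegree_C, zero_add]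
  have h3 : d 0 * 1 + d 1 * 1 ≤ u.totalDegree := by omega
  exact h2.trans ((add_le_add h0 h1).trans h3)

lemma eq_zero_of_evalP_eq_zero {u : MvPolynomial (Fin 2) ℝ} (h : ∀ p, evalP u p = 0) : u = 0 := by
  refine MvPolynomial.funext fun x => ?_
  have := h (x 0, x 1)
  rw [evalP] at this
  rw [map_zero, ← this]
  congr 2
  ext i
  fin_cases i <;> rfl

/-- A form of degree one is a linear function. -/
lemma evalP_linear {h : MvPolynomial (Fin 2) ℝ} (hh : h.IsHomogeneous 1) (x y : ℝ)
    (a b : ℝ × ℝ) : evalP h (x • a + y • b) = x * evalP h a + y * evalP h b := by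
  rw [← MvPolynomial.mem_homogeneousSubmodule, MvPolynomial.homogeneousSubmodule_one_eq_span_X] at hh
  induction hh using Submodule.span_induction with
  | mem _ hx => obtain ⟨i, rfl⟩ := hx; fin_cases i <;> simp [evalP]
  | zero => simp [evalP]
  | add u v _ _ hu hv => simp only [evalP, map_add] at *; rw [hu, hv]; ring
  | smul c u _ hu => simp only [evalP, MvPolynomial.smul_eval] at *; rw [hu]; ring

end PlanePolynomials

section Triangle

lemma det2_ne_zero {z A B : ℝ × ℝ} (h : AffineIndependent ℝ ![z, A, B]) :
    det2 (A - z) (B - z) ≠ 0 := by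
  intro h0
  rw [affineIndependent_iff] at h
  simp only [det2, Prod.fst_sub, Prod.snd_sub] at h0
  have key : ∀ x y : ℝ, x • (A - z) + y • (B - z) = 0 → x = 0 := by
    intro x y hxy
    refine h Finset.univ ![-x - y, x, y] (by simp [Fin.sum_univ_three]; ring) ?_ 1 (mem_univ _)
    rw [Fin.sum_univ_three, ← hxy]
    simp only [Matrix.cons_val]
    module
  have h1 : B.1 - z.1 = 0 := key _ (-(A.1 - z.1)) (by ext <;> simp <;> linarith)
  have h2 : B.2 - z.2 = 0 := key _ (-(A.2 - z.2)) (by ext <;> simp <;> linarith)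
  have hB : B - z = 0 := by ext <;> simpa
  have h3 := h Finset.univ ![-1, 0, 1] (by simp [Fin.sum_univ_three]) (by
    rw [Fin.sum_univ_three, ← hB]
    simp only [Matrix.cons_val]
    module) 2 (mem_univ _)
  simp at h3

lemma eq_combination {a b : ℝ × ℝ} (h : det2 a b ≠ 0) (p : ℝ × ℝ) :
    p = (det2 p b / det2 a b) • a + (det2 a p / det2 a b) • b := by
  ext <;> simp <;> field_simp <;> simp only [det2] <;> ring

lemma tri_eq {z A B : ℝ × ℝ} (h : AffineIndependent ℝ ![z, A, B]) :
    tri z A B = {p | ∃ x y : ℝ, 0 < x ∧ 0 < y ∧ x + y < 1 ∧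
      p = z + x • (A - z) + y • (B - z)} := by
  have hspan : affineSpan ℝ (Set.range ![z, A, B]) = ⊤ := by
    rw [h.affineSpan_eq_top_iff_card_eq_finrank_add_one]
    simp
  let β : AffineBasis (Fin 3) ℝ (ℝ × ℝ) := ⟨![z, A, B], h, hspan⟩
  have hr : ({z, A, B} : Set (ℝ × ℝ)) = Set.range β := by
    show _ = Set.range ![z, A, B]
    simp only [Matrix.range_cons, Matrix.range_empty, Set.union_empty, Set.singleton_union]
  rw [tri, hr, β.interior_convexHull]
  ext p
  constructor
  · intro hp
    have h1 := β.linear_combination_coord_eq_self p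
    have h2 := β.sum_coord_apply_eq_one p
    rw [Fin.sum_univ_three] at h1 h2
    refine ⟨β.coord 1 p, β.coord 2 p, hp 1, hp 2, by linarith [hp 0], ?_⟩
    have h3 : β.coord 0 p = 1 - β.coord 1 p - β.coord 2 p := by linarith
    nth_rewrite 1 [← h1]
    rw [h3]
    show _ • z + _ • A + _ • B = _
    module
  · rintro ⟨x, y, hx, hy, hxy, rfl⟩
    have hw : ∑ i : Fin 3, ![1 - x - y, x, y] i = 1 := by
      simp [Fin.sum_univ_three]; ring
    have hp : z + x • (A - z) + y • (B - z)
        = Finset.univ.affineCombination ℝ β ![1 - x - y, x, y] := by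
      rw [Finset.univ.affineCombination_eq_linear_combination _ _ hw, Fin.sum_univ_three]
      show _ = (1 - x - y) • z + x • A + y • B
      module
    intro i
    rw [hp, β.coord_apply_combination_of_mem (mem_univ i) hw]
    fin_cases i
    · show 0 < 1 - x - y
      linarith
    · exact hx
    · exact hy

lemma tri_eq_image {z A B : ℝ × ℝ} (h : AffineIndependent ℝ ![z, A, B]) :
    tri z A B = (fun p : ℝ × ℝ => z + (p.1 * (1 - p.2)) • (A - z) + (p.1 * p.2) • (B - z)) ''
      (Set.Ioo 0 1 ×ˢ Set.Ioo 0 1) := by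
  rw [tri_eq h]
  ext p
  constructor
  · rintro ⟨x, y, hx, hy, hxy, rfl⟩
    have hs : 0 < x + y := by linarith
    refine ⟨(x + y, y / (x + y)), ⟨⟨hs, hxy⟩, by positivity, ?_⟩, ?_⟩
    · rw [div_lt_one hs]; linarith
    · have h1 : (x + y) * (1 - y / (x + y)) = x := by field_simp; ring
      have h2 : (x + y) * (y / (x + y)) = y := by field_simp
      simp only [h1, h2]
  · rintro ⟨⟨s, t⟩, ⟨⟨hs, hs'⟩, ht, ht'⟩, rfl⟩
    refine ⟨s * (1 - t), s * t, mul_pos hs (sub_pos.2 ht'), mul_pos hs ht, ?_, rfl⟩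
    simp only at *
    linarith

end Triangle

section Moments

open Polynomial

lemma exists_radial_test {z a b : ℝ × ℝ} (hD : det2 a b ≠ 0) {j k : ℕ} (hjk : j ≤ k) (r : ℝ[X]) :
    ∃ w : MvPolynomial (Fin 2) ℝ, w.totalDegree ≤ k + r.natDegree ∧
      ∀ s t : ℝ, evalP w (z + (s * (1 - t)) • a + (s * t) • b) = t ^ j * s ^ k * r.eval s := by
  have hlin : ∀ c : ℝ × ℝ, ∃ g : MvPolynomial (Fin 2) ℝ, g.totalDegree ≤ 1 ∧
      ∀ p, evalP g p = det2 c (p - z) / det2 a b := by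
    intro c
    refine ⟨MvPolynomial.C (c.1 / det2 a b) * (MvPolynomial.X 1 - MvPolynomial.C z.2)
      - MvPolynomial.C (c.2 / det2 a b) * (MvPolynomial.X 0 - MvPolynomial.C z.1), ?_, ?_⟩
    · have hX : ∀ (i : Fin 2) (c d : ℝ), (MvPolynomial.C c * (MvPolynomial.X i - MvPolynomial.C d) :
          MvPolynomial (Fin 2) ℝ).totalDegree ≤ 1 := by
        intro i c d
        refine (MvPolynomial.totalDegree_mul _ _).trans ?_
        rw [MvPolynomial.totalDegree_C, zero_add]
        exact (MvPolynomial.totalDegree_sub _ _).trans (by simp)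
      exact (MvPolynomial.totalDegree_sub _ _).trans (max_le (hX _ _ _) (hX _ _ _))
    · intro p
      simp [evalP, det2]
      ring
  obtain ⟨Y, hY, hYe⟩ := hlin a
  obtain ⟨S, hS, hSe⟩ := hlin (a - b)
  have hpow : ∀ i : ℕ, (S ^ i).totalDegree ≤ i := fun i =>
    (MvPolynomial.totalDegree_pow _ _).trans (by nlinarith)
  have hYpow : ∀ i : ℕ, (Y ^ i).totalDegree ≤ i := fun i =>
    (MvPolynomial.totalDegree_pow _ _).trans (by nlinarith)
  have hr : (aeval S r).totalDegree ≤ r.natDegree := by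
    rw [aeval_eq_sum_range]
    refine MvPolynomial.totalDegree_finsetSum_le fun i hi => ?_
    exact (MvPolynomial.totalDegree_smul_le _ _).trans
      ((hpow i).trans (Nat.lt_succ_iff.1 (mem_range.1 hi)))
  refine ⟨Y ^ j * S ^ (k - j) * aeval S r, ?_, fun s t => ?_⟩
  · have h1 := MvPolynomial.totalDegree_mul (Y ^ j * S ^ (k - j)) (aeval S r)
    have h2 := MvPolynomial.totalDegree_mul (Y ^ j) (S ^ (k - j))
    have h3 := hpow (k - j)
    have h4 := hYpow j
    omega
  · set p := z + (s * (1 - t)) • a + (s * t) • b with hp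
    have e1 : evalP Y p = s * t := by
      rw [hYe, div_eq_iff hD, hp]
      simp [det2]
      ring
    have e2 : evalP S p = s := by
      rw [hSe, div_eq_iff hD, hp]
      simp [det2]
      ring
    have e3 : evalP (aeval S r) p = r.eval s := by
      rw [← e2, evalP, aeval_eq_sum_range, map_sum, eval_eq_sum_range]
      simp [evalP]
    have e4 : evalP (Y ^ j * S ^ (k - j) * aeval S r) p
        = evalP Y p ^ j * evalP S p ^ (k - j) * evalP (aeval S r) p := by simp [evalP]
    rw [e4, e1, e2, e3, mul_pow, mul_comm (s ^ j), mul_assoc (t ^ j), ← pow_add,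
      Nat.add_sub_cancel' hjk]

/-- The derivative of the collapsed (Duffy) parametrization of a triangle. -/
lemma hasFDerivAt_duffy (z a b : ℝ × ℝ) (p : ℝ × ℝ) :
    HasFDerivAt (fun p : ℝ × ℝ => z + (p.1 * (1 - p.2)) • a + (p.1 * p.2) • b)
      (Matrix.toLin (.finTwoProd ℝ) (.finTwoProd ℝ)
        !![(1 - p.2) * a.1 + p.2 * b.1, p.1 * (b.1 - a.1);
          (1 - p.2) * a.2 + p.2 * b.2, p.1 * (b.2 - a.2)]).toContinuousLinearMap p := by
  rw [Matrix.toLin_finTwoProd_toContinuousLinearMap]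
  have h1 : HasFDerivAt (fun p : ℝ × ℝ => p.1) (ContinuousLinearMap.fst ℝ ℝ ℝ) p := hasFDerivAt_fst
  have h2 : HasFDerivAt (fun p : ℝ × ℝ => p.2) (ContinuousLinearMap.snd ℝ ℝ ℝ) p := hasFDerivAt_snd
  have key := (((h1.mul (h2.const_sub 1)).smul_const a).const_add z).add ((h1.mul h2).smul_const b)
  convert! key using 1
  ext <;> simp <;> ring

lemma injOn_duffy {a b : ℝ × ℝ} (z : ℝ × ℝ) (hD : det2 a b ≠ 0) :
    Set.InjOn (fun p : ℝ × ℝ => z + (p.1 * (1 - p.2)) • a + (p.1 * p.2) • b)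
      (Set.Ioo 0 1 ×ˢ Set.Ioo 0 1) := by
  rintro ⟨s, t⟩ ⟨⟨hs, -⟩, -⟩ ⟨s', t'⟩ - h
  have e1 := congrArg Prod.fst h
  have e2 := congrArg Prod.snd h
  simp at e1 e2 hs
  have h1 : s * t = s' * t' := by
    refine mul_right_cancel₀ hD ?_
    simp only [det2]
    linear_combination a.1 * e2 - a.2 * e1
  have h2 : s * (1 - t) = s' * (1 - t') := by
    refine mul_right_cancel₀ hD ?_
    simp only [det2]
    linear_combination b.2 * e1 - b.1 * e2
  have h3 : s = s' := by linarith
  subst h3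
  rw [mul_right_inj' hs.ne'] at h1
  rw [h1]

lemma bubble_duffy {z A B : ℝ × ℝ} (hD : det2 (A - z) (B - z) ≠ 0) (s t : ℝ) :
    bubble z A B (z + (s * (1 - t)) • (A - z) + (s * t) • (B - z))
      = (1 - s) * (s * (1 - t)) * (s * t) := by
  have h0 : det2 (z - A) (B - A) = -det2 (A - z) (B - z) := by simp [det2]; ring
  have h1 : det2 (A - B) (z - B) = -det2 (A - z) (B - z) := by simp [det2]; ring
  have h2 : det2 (B - z) (A - z) = -det2 (A - z) (B - z) := by simp [det2]; ring
  have e0 : bary z A B (z + (s * (1 - t)) • (A - z) + (s * t) • (B - z)) = 1 - s := by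
    rw [bary, h0, div_eq_iff (neg_ne_zero.2 hD)]
    simp [det2]
    ring
  have e1 : bary A B z (z + (s * (1 - t)) • (A - z) + (s * t) • (B - z)) = s * (1 - t) := by
    rw [bary, h1, div_eq_iff (neg_ne_zero.2 hD)]
    simp [det2]
    ring
  have e2 : bary B z A (z + (s * (1 - t)) • (A - z) + (s * t) • (B - z)) = s * t := by
    rw [bary, h2, div_eq_iff (neg_ne_zero.2 hD)]
    simp [det2]
    ring
  rw [bubble, e0, e1, e2]

lemma innerT_eq_integral_duffy {z A B : ℝ × ℝ} (h : AffineIndependent ℝ ![z, A, B])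
    (u w : MvPolynomial (Fin 2) ℝ) :
    innerT z A B u w = ∫ p in Set.Ioo (0 : ℝ) 1 ×ˢ Set.Ioo (0 : ℝ) 1, |det2 (A - z) (B - z)| *
      (evalP u (z + (p.1 * (1 - p.2)) • (A - z) + (p.1 * p.2) • (B - z)) *
       evalP w (z + (p.1 * (1 - p.2)) • (A - z) + (p.1 * p.2) • (B - z)) *
        (p.1 ^ 3 * (1 - p.1) * (p.2 * (1 - p.2)))) := by
  have hD := det2_ne_zero h
  have hmeas : MeasurableSet (Set.Ioo (0 : ℝ) 1 ×ˢ Set.Ioo (0 : ℝ) 1) :=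
    measurableSet_Ioo.prod measurableSet_Ioo
  rw [innerT, tri_eq_image h, integral_image_eq_integral_abs_det_fderiv_smul volume hmeas
    (fun p _ => (hasFDerivAt_duffy z (A - z) (B - z) p).hasFDerivWithinAt) (injOn_duffy z hD)]
  refine setIntegral_congr_fun hmeas fun p hp => ?_
  have hdet : (Matrix.toLin (.finTwoProd ℝ) (.finTwoProd ℝ)
      !![(1 - p.2) * (A - z).1 + p.2 * (B - z).1, p.1 * ((B - z).1 - (A - z).1);
        (1 - p.2) * (A - z).2 + p.2 * (B - z).2,
          p.1 * ((B - z).2 - (A - z).2)]).toContinuousLinearMap.det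
      = p.1 * det2 (A - z) (B - z) := by
    rw [ContinuousLinearMap.det, LinearMap.coe_toContinuousLinearMap, LinearMap.det_toLin,
      Matrix.det_fin_two_of]
    simp only [det2]
    ring
  simp only [hdet, bubble_duffy hD, abs_mul, abs_of_pos hp.1.1, smul_eq_mul]
  ring

lemma sum_homogeneousComponent_of_le {v : MvPolynomial (Fin 2) ℝ} {n : ℕ} (hv : v.totalDegree ≤ n) :
    ∑ l ∈ range (n + 1), MvPolynomial.homogeneousComponent l v = v := by
  conv_rhs => rw [← MvPolynomial.sum_homogeneousComponent v]
  refine (sum_subset (range_subset_range.2 (by omega)) fun l _ hl => ?_).symm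
  exact MvPolynomial.homogeneousComponent_eq_zero _ _ (by simpa using hl)

/-- Radial generating polynomial of the `j`-th edge moments of the homogeneous parts of `v`. -/
def momentPoly (n j : ℕ) (a b : ℝ × ℝ) (v : MvPolynomial (Fin 2) ℝ) : ℝ[X] :=
  ∑ l ∈ range (n + 1),
    C (unitInt (edgePoly a b (MvPolynomial.homogeneousComponent l v) * X ^ j * (X * (1 - X)))) * X ^ l

lemma natDegree_momentPoly_le (n j : ℕ) (a b : ℝ × ℝ) (v : MvPolynomial (Fin 2) ℝ) :
    (momentPoly n j a b v).natDegree ≤ n :=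
  natDegree_sum_le_of_forall_le _ _ fun _ hl =>
    (natDegree_C_mul_X_pow_le _ _).trans (Nat.lt_succ_iff.1 (mem_range.1 hl))

lemma coeff_momentPoly {n l : ℕ} (hl : l ≤ n) (j : ℕ) (a b : ℝ × ℝ) (v : MvPolynomial (Fin 2) ℝ) :
    (momentPoly n j a b v).coeff l
      = unitInt (edgePoly a b (MvPolynomial.homogeneousComponent l v) * X ^ j * (X * (1 - X))) := by
  simp [momentPoly, finsetSum_coeff, coeff_C_mul, coeff_X_pow, Nat.lt_succ_iff.2 hl]

lemma integrableOn_duffy {g : ℝ × ℝ → ℝ} (hg : Continuous g) :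
    IntegrableOn g (Set.Ioo (0 : ℝ) 1 ×ˢ Set.Ioo (0 : ℝ) 1) :=
  (hg.continuousOn.integrableOn_compact (isCompact_Icc.prod isCompact_Icc)).mono_set
    (Set.prod_mono Set.Ioo_subset_Icc_self Set.Ioo_subset_Icc_self)

lemma unitInt_momentPoly {n : ℕ} {z A B : ℝ × ℝ} (h : AffineIndependent ℝ ![z, A, B])
    {u : MvPolynomial (Fin 2) ℝ} (hu : inPerp n z A B u) {j k : ℕ} (hjk : j ≤ k) (r : ℝ[X])
    (hr : k + r.natDegree ≤ n - 1) :
    unitInt (momentPoly n j (A - z) (B - z) (recenter z u) * (X ^ k * r * (X ^ 3 * (1 - X)))) = 0 := by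
  have hD := det2_ne_zero h
  obtain ⟨w, hw, hwe⟩ := exists_radial_test (z := z) hD hjk r
  have key := hu.2 w (hw.trans hr)
  set f : ℕ → ℝ[X] := fun l =>
    edgePoly (A - z) (B - z) (MvPolynomial.homogeneousComponent l (recenter z u)) with hf
  have hue : ∀ s t : ℝ, s ≠ 0 → evalP u (z + (s * (1 - t)) • (A - z) + (s * t) • (B - z))
      = ∑ l ∈ range (n + 1), s ^ l * (f l).eval t := by
    intro s t hs
    rw [add_assoc, ← evalP_recenter]
    conv_lhs => rw [← sum_homogeneousComponent_of_le ((totalDegree_recenter_le z u).trans hu.1)]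
    rw [evalP, map_sum]
    refine sum_congr rfl fun l _ => ?_
    have hst : s * (1 - t) + s * t = s := by ring
    have := evalP_combination (MvPolynomial.homogeneousComponent_isHomogeneous l (recenter z u))
      (A - z) (B - z) (x := s * (1 - t)) (y := s * t) (by rwa [hst])
    rw [evalP, hst, mul_div_cancel_left₀ _ hs] at this
    rw [this]
  rw [innerT_eq_integral_duffy h, integral_const_mul, mul_eq_zero,
    or_iff_right (abs_ne_zero.2 hD)] at key
  have hmeas : MeasurableSet (Set.Ioo (0 : ℝ) 1 ×ˢ Set.Ioo (0 : ℝ) 1) :=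
    measurableSet_Ioo.prod measurableSet_Ioo
  rw [setIntegral_congr_fun (g := fun p : ℝ × ℝ => ∑ l ∈ range (n + 1),
      (X ^ l * (X ^ k * r * (X ^ 3 * (1 - X)))).eval p.1 *
        (f l * X ^ j * (X * (1 - X))).eval p.2) hmeas ?_, integral_finsetSum] at key
  · rw [momentPoly, sum_mul, unitInt_sum, ← key]
    refine sum_congr rfl fun l _ => ?_
    rw [Measure.volume_eq_prod, setIntegral_prod_mul (fun s => eval s _) (fun t => eval t _),
      mul_assoc, unitInt_C_mul, mul_comm]
    rfl
  · intro l _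
    exact integrableOn_duffy (((Polynomial.continuous _).comp continuous_fst).mul
      ((Polynomial.continuous _).comp continuous_snd))
  · rintro ⟨s, t⟩ ⟨⟨hs, -⟩, -⟩
    simp only [hue s t hs.ne', hwe, sum_mul]
    refine sum_congr rfl fun l _ => ?_
    simp
    ring

end Moments

section Cones

open Polynomial

/-- `P` lies in the open cone spanned by `a` and `b`. -/
def InCone (a b P : ℝ × ℝ) : Prop := ∃ x y : ℝ, 0 < x ∧ 0 < y ∧ P = x • a + y • b

lemma inCone_or_neg {a b : ℝ × ℝ} {x y : ℝ} (h : 0 < x * y) :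
    InCone a b (x • a + y • b) ∨ InCone a b (-(x • a + y • b)) := by
  rcases mul_pos_iff.1 h with ⟨hx, hy⟩ | ⟨hx, hy⟩
  · exact Or.inl ⟨x, y, hx, hy, rfl⟩
  · exact Or.inr ⟨-x, -y, by linarith, by linarith, by module⟩

lemma inCone_of_orthogonal {a b : ℝ × ℝ} (hD : det2 a b ≠ 0) {h : MvPolynomial (Fin 2) ℝ} {m : ℕ}
    (hh : h.IsHomogeneous m) (hc : (edgePoly a b h).coeff m ≠ 0)
    (hroots : ∀ t, (edgePoly a b h).eval t = 0 → 0 < t ∧ t < 1) {P : ℝ × ℝ} (hP : P ≠ 0)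
    (h0 : evalP h P = 0) : InCone a b P ∨ InCone a b (-P) := by
  obtain ⟨x, y, rfl⟩ : ∃ x y : ℝ, P = x • a + y • b := ⟨_, _, eq_combination hD P⟩
  by_cases hxy : x + y = 0
  · have hy : y ≠ 0 := by
      rintro rfl
      rw [add_zero] at hxy
      simp [hxy] at hP
    have e : x • a + y • b = y • (b - a) := by
      rw [eq_neg_of_add_eq_zero_left hxy]
      module
    rw [e, evalP_smul hh, evalP_sub_eq_coeff hh] at h0
    exact absurd h0 (mul_ne_zero (pow_ne_zero _ hy) hc)
  · rw [evalP_combination hh _ _ hxy, mul_eq_zero, or_iff_right (pow_ne_zero _ hxy)] at h0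
    obtain ⟨h1, h2⟩ := hroots _ h0
    refine inCone_or_neg ?_
    have hs : 0 < (x + y) ^ 2 := by positivity
    have : x * y = (x + y) ^ 2 * ((y / (x + y)) * (1 - y / (x + y))) := by
      field_simp
      ring
    rw [this]
    exact mul_pos hs (mul_pos h1 (sub_pos.2 h2))

lemma edgePoly_ne_zero {a b : ℝ × ℝ} (hD : det2 a b ≠ 0) {h : MvPolynomial (Fin 2) ℝ} {m : ℕ}
    (hh : h.IsHomogeneous m) (hne : h ≠ 0) : edgePoly a b h ≠ 0 := by
  intro hz
  refine hne (eq_zero_of_evalP_eq_zero fun P => ?_)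
  rw [eq_combination hD P]
  set x := det2 P b / det2 a b
  set y := det2 a P / det2 a b
  by_cases hxy : x + y = 0
  · have e : x • a + y • b = y • (b - a) := by
      rw [eq_neg_of_add_eq_zero_left hxy]
      module
    rw [e, evalP_smul hh, evalP_sub_eq_coeff hh, hz, coeff_zero, mul_zero]
  · rw [evalP_combination hh _ _ hxy, hz, eval_zero, mul_zero]

lemma inCone_of_linear {a b : ℝ × ℝ} (hD : det2 a b ≠ 0) {h : MvPolynomial (Fin 2) ℝ}
    (hh : h.IsHomogeneous 1) (hab : evalP h a * evalP h b < 0) {P : ℝ × ℝ} (hP : P ≠ 0)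
    (h0 : evalP h P = 0) : InCone a b P ∨ InCone a b (-P) := by
  obtain ⟨x, y, rfl⟩ : ∃ x y : ℝ, P = x • a + y • b := ⟨_, _, eq_combination hD P⟩
  rw [evalP_linear hh] at h0
  have ha : evalP h a ≠ 0 := fun h => by simp [h] at hab
  have hb : evalP h b ≠ 0 := fun h => by simp [h] at hab
  have hy : y ≠ 0 := by
    rintro rfl
    simp only [zero_mul, add_zero, mul_eq_zero, ha, or_false] at h0
    simp [h0] at hP
  refine inCone_or_neg ?_
  have h1 : x * y * (evalP h a) ^ 2 = -(evalP h a * evalP h b) * y ^ 2 := by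
    linear_combination y * evalP h a * h0
  have h2 : 0 < -(evalP h a * evalP h b) * y ^ 2 := mul_pos (by linarith) (by positivity)
  rw [← h1] at h2
  exact pos_of_mul_pos_left h2 (sq_nonneg _)

variable {q : ℕ}

lemma TrianglePatch.eq_of_inCone (T : TrianglePatch q) {i j : ZMod q} {P : ℝ × ℝ}
    (hi : InCone (T.A (i - 1) - T.z) (T.A i - T.z) P)
    (hj : InCone (T.A (j - 1) - T.z) (T.A j - T.z) P) : i = j := by
  by_contra hij
  obtain ⟨x, y, hx, hy, hP⟩ := hi
  obtain ⟨x', y', hx', hy', hP'⟩ := hj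
  obtain ⟨c, hc, h1, h2⟩ : ∃ c : ℝ, 0 < c ∧ c * (x + y) < 1 ∧ c * (x' + y') < 1 := by
    refine ⟨1 / (1 + (x + y) + (x' + y')), by positivity, ?_, ?_⟩ <;>
    · rw [one_div_mul_eq_div, div_lt_one (by positivity)]
      linarith
  refine Set.disjoint_left.1 (T.disj hij) (?_ : T.z + c • P ∈ _) ?_
  · rw [tri_eq (T.indep i)]
    exact ⟨c * x, c * y, by positivity, by positivity, by linarith, by rw [hP]; module⟩
  · rw [tri_eq (T.indep j)]
    exact ⟨c * x', c * y', by positivity, by positivity, by linarith, by rw [hP']; module⟩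

/-- A line through the centre cannot meet the cones of three consecutive triangles. -/
lemma TrianglePatch.not_line_through_three (T : TrianglePatch q) (i : ZMod q) (P : ℝ × ℝ)
    (h : ∀ k : ZMod q, k = i ∨ k = i + 1 ∨ k = i + 2 →
      InCone (T.A (k - 1) - T.z) (T.A k - T.z) P ∨
        InCone (T.A (k - 1) - T.z) (T.A k - T.z) (-P)) : False := by
  have hq := T.hq
  have h1 : (1 : ZMod q) ≠ 0 := by
    have := (ZMod.natCast_eq_zero_iff 1 q).not.2 (Nat.not_dvd_of_pos_of_lt one_pos (by omega))
    simpa using this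
  have h2 : (2 : ZMod q) ≠ 0 := by
    have := (ZMod.natCast_eq_zero_iff 2 q).not.2 (Nat.not_dvd_of_pos_of_lt two_pos (by omega))
    simpa using this
  have n1 : i ≠ i + 1 := by simpa using h1
  have n2 : i ≠ i + 2 := by simpa using h2
  have n3 : i + 1 ≠ i + 2 := fun h => h1 (by linear_combination -h)
  rcases h i (by simp) with a | a <;> rcases h (i + 1) (by simp) with b | b <;>
    rcases h (i + 2) (by simp) with c | c
  · exact n1 (T.eq_of_inCone a b)
  · exact n1 (T.eq_of_inCone a b)
  · exact n2 (T.eq_of_inCone a c)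
  · exact n3 (T.eq_of_inCone b c)
  · exact n3 (T.eq_of_inCone b c)
  · exact n2 (T.eq_of_inCone a c)
  · exact n1 (T.eq_of_inCone a b)
  · exact n1 (T.eq_of_inCone a b)

/-- A nonzero linear function takes a negative value at some vertex around the centre. -/
lemma TrianglePatch.exists_neg_vertex (T : TrianglePatch q) {h : MvPolynomial (Fin 2) ℝ}
    (hh : h.IsHomogeneous 1) {C : ℝ} (hC : C ≠ 0) {P : ℝ × ℝ} (hP : evalP h P ≠ 0) :
    ∃ i, C * evalP h (T.A i - T.z) < 0 := by
  by_contra! hcon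
  have hsub : ∀ i, closure (tri T.z (T.A (i - 1)) (T.A i)) ⊆ {p | 0 ≤ C * evalP h (p - T.z)} := by
    intro i
    refine closure_minimal ?_ (isClosed_le continuous_const
      (continuous_const.mul ((continuous_evalP h).comp (by fun_prop))))
    rw [tri_eq (T.indep i)]
    rintro p ⟨x, y, hx, hy, -, rfl⟩
    have e : T.z + x • (T.A (i - 1) - T.z) + y • (T.A i - T.z) - T.z
        = x • (T.A (i - 1) - T.z) + y • (T.A i - T.z) := by module
    show 0 ≤ C * evalP h _
    rw [e, evalP_linear hh]
    have h1 := mul_nonneg hx.le (hcon (i - 1))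
    have h2 := mul_nonneg hy.le (hcon i)
    linarith
  obtain ⟨ε, hε, hball⟩ := T.covers
  have hnonneg : ∀ p ∈ Metric.ball T.z ε, 0 ≤ C * evalP h (p - T.z) := by
    intro p hp
    obtain ⟨i, hi⟩ := Set.mem_iUnion.1 (hball hp)
    exact hsub i hi
  obtain ⟨c, hc, hcP⟩ : ∃ c : ℝ, 0 < c ∧ c * ‖P‖ < ε := by
    refine ⟨ε / (1 + ‖P‖), by positivity, ?_⟩
    rw [div_mul_eq_mul_div, div_lt_iff₀ (by positivity)]
    nlinarith
  have h1 := hnonneg (T.z + c • P) (by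
    simpa [dist_eq_norm, norm_smul, abs_of_pos hc] using hcP)
  have h2 := hnonneg (T.z + (-c) • P) (by
    simpa [dist_eq_norm, norm_smul, abs_of_pos hc] using hcP)
  rw [add_sub_cancel_left, evalP_smul hh, pow_one] at h1 h2
  have h3 : c * (C * evalP h P) = 0 := by linarith
  exact mul_ne_zero hc.ne' (mul_ne_zero hC hP) h3

lemma unitInt_X_pow (k : ℕ) : unitInt (X ^ k) = 1 / (k + 1) := by
  simp only [unitInt, eval_pow, eval_X]
  rw [← integral_Ioc_eq_integral_Ioo, ← intervalIntegral.integral_of_le zero_le_one]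
  simp [integral_pow]

lemma unitInt_linear_mul (α β : ℝ) :
    unitInt ((C α + C β * X) * (X * (1 - X))) = α / 6 + β / 12 := by
  have : (C α + C β * X) * (X * (1 - X)) = C α * (X ^ 1 - X ^ 2) + C β * (X ^ 2 - X ^ 3) := by ring
  rw [this, unitInt_add, unitInt_C_mul, unitInt_C_mul, unitInt_sub, unitInt_sub]
  simp only [unitInt_X_pow]
  norm_num
  ring

lemma edgePoly_linear {h : MvPolynomial (Fin 2) ℝ} (hh : h.IsHomogeneous 1) (a b : ℝ × ℝ) :
    edgePoly a b h = C (evalP h a) + C (evalP h b - evalP h a) * X := by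
  refine Polynomial.funext fun t => ?_
  have : a + t • (b - a) = (1 - t) • a + t • b := by module
  rw [eval_edgePoly, this, evalP_linear hh]
  simp
  ring

/-- No nonzero polynomial is orthogonal to `P_{n-1}` on all triangles of a patch. -/
lemma TrianglePatch.eq_zero_of_inPerp (T : TrianglePatch q) {n : ℕ} (hn : 1 ≤ n)
    {u : MvPolynomial (Fin 2) ℝ} (hu : ∀ i, inPerp n T.z (T.A (i - 1)) (T.A i) u) : u = 0 := by
  by_contra hne
  set v := recenter T.z u with hv
  have hvdeg : v.totalDegree ≤ n := (totalDegree_recenter_le _ _).trans (hu 0).1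
  have hex : ∃ l, MvPolynomial.homogeneousComponent l v ≠ 0 := by
    by_contra! hall
    refine hne (eq_zero_of_evalP_eq_zero fun p => ?_)
    have hv0 : v = 0 := by
      rw [← MvPolynomial.sum_homogeneousComponent v]
      exact sum_eq_zero fun l _ => hall l
    have := evalP_recenter T.z u (p - T.z)
    rw [← hv, hv0, add_sub_cancel] at this
    rw [← this]
    simp [evalP]
  classical
  obtain ⟨m, hm, hmin⟩ : ∃ m, MvPolynomial.homogeneousComponent m v ≠ 0 ∧
      ∀ l < m, MvPolynomial.homogeneousComponent l v = 0 :=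
    ⟨Nat.find hex, Nat.find_spec hex, fun l hl => not_not.1 (Nat.find_min hex hl)⟩
  have hmn : m ≤ n := by
    by_contra! hlt
    exact hm (MvPolynomial.homogeneousComponent_eq_zero _ _ (hvdeg.trans_lt hlt))
  have hD : ∀ i, det2 (T.A (i - 1) - T.z) (T.A i - T.z) ≠ 0 := fun i => det2_ne_zero (T.indep i)
  rcases Nat.eq_zero_or_pos m with rfl | hmpos
  · have hdeg := fun i => natDegree_momentPoly_le n 0 (T.A (i - 1) - T.z) (T.A i - T.z) v
    set φ : ZMod q → ℝ[X] := fun i => momentPoly n 0 (T.A (i - 1) - T.z) (T.A i - T.z) v with hφ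
    have horth : ∀ i, ∀ r : ℝ[X], r.natDegree ≤ n - 1 →
        unitInt (φ i * (r * (X ^ 3 * (1 - X)))) = 0 := by
      intro i r hr
      have := unitInt_momentPoly (T.indep i) (hu i) (le_refl 0) r (by omega)
      rwa [pow_zero, one_mul] at this
    rw [MvPolynomial.homogeneousComponent_zero] at hm
    set c := MvPolynomial.coeff 0 v
    have hc : c ≠ 0 := by
      rintro h0
      simp [h0] at hm
    have hcoeff0 : ∀ i, (φ i).coeff 0 = c / 6 := by
      intro i
      have e : edgePoly (T.A (i - 1) - T.z) (T.A i - T.z) (MvPolynomial.C c) = C c + C 0 * X := by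
        simp [edgePoly]
      rw [hφ, coeff_momentPoly (Nat.zero_le n), MvPolynomial.homogeneousComponent_zero, e,
        pow_zero, mul_one, unitInt_linear_mul]
      ring
    set h := MvPolynomial.homogeneousComponent 1 v
    have hh : h.IsHomogeneous 1 := MvPolynomial.homogeneousComponent_isHomogeneous 1 v
    have hcoeff1 : ∀ i, (φ i).coeff 1
        = (evalP h (T.A (i - 1) - T.z) + evalP h (T.A i - T.z)) / 12 := by
      intro i
      rw [hφ, coeff_momentPoly hn, edgePoly_linear hh, pow_zero, mul_one, unitInt_linear_mul]
      ring
    have hsame : ∀ i, φ i = φ 0 := by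
      intro i
      rw [← sub_eq_zero]
      refine eq_zero_of_coeff_zero ((natDegree_sub_le _ _).trans (max_le (hdeg i) (hdeg 0)))
        (fun r hr => ?_) (by rw [coeff_sub, hcoeff0, hcoeff0, sub_self])
      rw [sub_mul, unitInt_sub, horth i r hr, horth 0 r hr, sub_zero]
    have hC : (φ 0).coeff 1 ≠ 0 := by
      intro h1
      have := hcoeff0 0
      have hz : φ 0 = 0 := eq_zero_of_coeff_one hn (hdeg 0) (horth 0) h1
      rw [hz, coeff_zero] at this
      exact hc (by linarith)
    set C₀ := (φ 0).coeff 1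
    have hsum : ∀ i, evalP h (T.A (i - 1) - T.z) + evalP h (T.A i - T.z) = 12 * C₀ := by
      intro i
      have := hcoeff1 i
      rw [hsame i] at this
      linarith
    obtain ⟨P, hP⟩ : ∃ P, evalP h P ≠ 0 := by
      by_contra! hall
      have := hsum 0
      rw [hall, hall] at this
      exact hC (by linarith)
    obtain ⟨i, hi⟩ := T.exists_neg_vertex hh hC hP
    have hpos : 0 < C₀ ^ 2 := by positivity
    set H : ZMod q → ℝ := fun k => evalP h (T.A k - T.z) with hH
    have s0 : H (i - 1) + H i = 12 * C₀ := hsum i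
    have s1 : H i + H (i + 1) = 12 * C₀ := by simpa using hsum (i + 1)
    have s2 : H (i + 1) + H (i + 2) = 12 * C₀ := by
      have := hsum (i + 2)
      rwa [show i + 2 - 1 = i + 1 by ring] at this
    have hi' : C₀ * H i < 0 := hi
    have hneg : H (i - 1) * H i < 0 := by
      have e : C₀ ^ 2 * (H (i - 1) * H i) = (C₀ * H i) * (12 * C₀ ^ 2 - C₀ * H i) := by
        rw [eq_sub_of_add_eq s0]; ring
      have : (C₀ * H i) * (12 * C₀ ^ 2 - C₀ * H i) < 0 :=
        mul_neg_of_neg_of_pos hi' (by linarith)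
      rw [← e] at this
      exact neg_of_mul_neg_right this hpos.le
    have e1 : H (i + 1) = H (i - 1) := by linarith
    have e2 : H (i + 2) = H i := by linarith
    have hP0 : evalP h (H i • (T.A (i - 1) - T.z) + (-H (i - 1)) • (T.A i - T.z)) = 0 := by
      rw [evalP_linear hh]
      show H i * H (i - 1) + -H (i - 1) * H i = 0
      ring
    refine T.not_line_through_three i _ fun k hk => inCone_of_linear (hD k) hh ?_ ?_ hP0
    · show H (k - 1) * H k < 0
      rcases hk with rfl | rfl | rfl
      · exact hneg
      · rw [add_sub_cancel_right, e1, mul_comm]; exact hneg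
      · rw [show i + 2 - 1 = i + 1 by ring, e1, e2]; exact hneg
    · intro hz
      have h1 := congrArg (fun p => det2 p (T.A i - T.z)) hz
      have h2 : H i * det2 (T.A (i - 1) - T.z) (T.A i - T.z) = 0 := by
        simp only [det2, Prod.fst_add, Prod.snd_add, Prod.smul_fst, Prod.smul_snd, smul_eq_mul,
          Prod.fst_zero, Prod.snd_zero] at h1 ⊢
        linarith
      rcases mul_eq_zero.1 h2 with h3 | h3
      · simp [h3] at hneg
      · exact hD i h3
  · set h := MvPolynomial.homogeneousComponent m v
    have hh : h.IsHomogeneous m := MvPolynomial.homogeneousComponent_isHomogeneous m v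
    have hroots := fun i => orthogonal_roots (m := m) hmpos (edgePoly_ne_zero (hD i) hh hm)
      (natDegree_edgePoly_le _ _ hh.totalDegree_le) (fun j hj => by
        rw [← coeff_momentPoly hmn, coeff_eq_zero_of_unitInt (m := m) hmpos
          (natDegree_momentPoly_le n j _ _ v) (fun l hl => ?_) fun r hr => ?_, coeff_zero]
        · rw [coeff_momentPoly (by omega), hmin l hl]
          simp [edgePoly, unitInt]
        · exact unitInt_momentPoly (T.indep i) (hu i) (by omega) r hr)
    obtain ⟨t, ht⟩ := (hroots 0).2.2
    rw [eval_edgePoly] at ht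
    refine T.not_line_through_three 0 _ fun k _ =>
      inCone_of_orthogonal (hD k) hh (hroots k).1 (hroots k).2.1 (fun hz => ?_) ht
    have e : T.A (0 - 1) - T.z + t • (T.A 0 - T.z - (T.A (0 - 1) - T.z))
        = (1 - t) • (T.A (0 - 1) - T.z) + t • (T.A 0 - T.z) := by module
    rw [e] at hz
    have h1 : (1 - t) * det2 (T.A (0 - 1) - T.z) (T.A 0 - T.z) = 0 := by
      have := congrArg (fun p => det2 p (T.A 0 - T.z)) hz
      simp only [det2, Prod.fst_add, Prod.snd_add, Prod.smul_fst, Prod.smul_snd, smul_eq_mul,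
        Prod.fst_zero, Prod.snd_zero] at this ⊢
      linarith
    have h2 : t * det2 (T.A (0 - 1) - T.z) (T.A 0 - T.z) = 0 := by
      have := congrArg (fun p => det2 (T.A (0 - 1) - T.z) p) hz
      simp only [det2, Prod.fst_add, Prod.snd_add, Prod.smul_fst, Prod.smul_snd, smul_eq_mul,
        Prod.fst_zero, Prod.snd_zero] at this ⊢
      linarith
    exact hD 0 (by linarith)

end Cones

lemma continuous_bubble (A B C : ℝ × ℝ) : Continuous (bubble A B C) := by
  unfold bubble bary det2
  fun_prop

lemma integrableOn_tri {g : ℝ × ℝ → ℝ} (hg : Continuous g) (A B C : ℝ × ℝ) :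
    IntegrableOn g (tri A B C) :=
  (hg.continuousOn.integrableOn_compact
    ((Set.toFinite {A, B, C}).isCompact_convexHull ℝ)).mono_set interior_subset

lemma innerT_sub (A B C : ℝ × ℝ) (u v w : MvPolynomial (Fin 2) ℝ) :
    innerT A B C (u - v) w = innerT A B C u w - innerT A B C v w := by
  have hint : ∀ u : MvPolynomial (Fin 2) ℝ,
      IntegrableOn (fun p => evalP u p * evalP w p * bubble A B C p) (tri A B C) := fun u =>
    integrableOn_tri
      (((continuous_evalP u).mul (continuous_evalP w)).mul (continuous_bubble A B C)) A B C
  rw [innerT, innerT, innerT, ← integral_sub (hint u) (hint v)]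
  congr 1
  ext p
  simp only [evalP, map_sub]
  ring

lemma innerT_zero_right (A B C : ℝ × ℝ) (u : MvPolynomial (Fin 2) ℝ) : innerT A B C u 0 = 0 := by
  simp [innerT, evalP]

lemma patchInner_single {q : ℕ} (T : TrianglePatch q) (u : ZMod q → MvPolynomial (Fin 2) ℝ)
    (i : ZMod q) (w : MvPolynomial (Fin 2) ℝ) :
    patchInner T u (Pi.single i w) = innerT T.z (T.A (i - 1)) (T.A i) (u i) w := by
  rw [patchInner, sum_eq_single i]
  · rw [Pi.single_eq_same]
  · intro j _ hj
    rw [Pi.single_eq_of_ne hj, innerT_zero_right]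
  · simp

/-- Let `n ≥ 1` and let `𝒯` be a triangle patch around `z ∈ ℝ²`.
Let `proj` be the orthogonal projection (w.r.t. `(·,·)_𝒯`) of the piecewise polynomials of
degree `≤ n` onto the piecewise polynomials of degree `≤ n-1`, characterized by the two
hypotheses `hdeg` and `hproj`.  Then the restriction `Π_n^𝒯` of `proj` to `P_n(Ω)`
(global polynomials, embedded as constant tuples) is injective. -/
theorem statement2 (n q : ℕ) (hn : 1 ≤ n) (T : TrianglePatch q)
    (proj : (ZMod q → MvPolynomial (Fin 2) ℝ) → ZMod q → MvPolynomial (Fin 2) ℝ)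
    (hdeg : ∀ v : ZMod q → MvPolynomial (Fin 2) ℝ,
      (∀ i, (v i).totalDegree ≤ n) → ∀ i, (proj v i).totalDegree ≤ n - 1)
    (hproj : ∀ v : ZMod q → MvPolynomial (Fin 2) ℝ, (∀ i, (v i).totalDegree ≤ n) →
      ∀ w : ZMod q → MvPolynomial (Fin 2) ℝ, (∀ i, (w i).totalDegree ≤ n - 1) →
        patchInner T (fun i => v i - proj v i) w = 0) :
    ∀ u v : MvPolynomial (Fin 2) ℝ, u.totalDegree ≤ n → v.totalDegree ≤ n →
      proj (fun _ => u) = proj (fun _ => v) → u = v := by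
  intro u v hu hv huv
  rw [← sub_eq_zero]
  refine T.eq_zero_of_inPerp hn fun i =>
    ⟨(MvPolynomial.totalDegree_sub _ _).trans (max_le hu hv), fun w hw => ?_⟩
  have hw' : ∀ j, ((Pi.single i w : ZMod q → MvPolynomial (Fin 2) ℝ) j).totalDegree ≤ n - 1 := by
    intro j
    rcases eq_or_ne j i with rfl | hj
    · rwa [Pi.single_eq_same]
    · rw [Pi.single_eq_of_ne hj]; simp
  have h1 := hproj (fun _ => u) (fun _ => hu) _ hw'
  have h2 := hproj (fun _ => v) (fun _ => hv) _ hw'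
  rw [patchInner_single, innerT_sub] at h1 h2
  rw [huv] at h1
  rw [innerT_sub]
  linarith
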